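/- Let A1 and A2 be discrete random variables on finite sets 𝒜1 and 𝒜2, let 𝒜3 be a finite set, and let F be a random variable taking values in a set ℱ of functions from 𝒜1 to 𝒜3. Assume that A1 and F are conditionally independent given A2, and that for every fixed realization a2 of A2 the conditional distribution of F given A2 = a2 satisfies the two-universal condition (for all x1 ≠ x2 in 𝒜1, Pr[F(x1) = F(x2) | A2 = a2] ≤ 1/|𝒜3|). Then for all 0 ≤ ρ ≤ 1, E_f[ exp( ρ · I(F(A1); A2 | F = f) ) ] ≤ 1 + |𝒜3|^ρ · E[ P_{A1|A2}(A1|A2)^ρ ], where the expectation E_f is over the distribution of F, I denotes mutual information in nats (natural logarithm), and P_{A1|A2}(a1|a2) is the conditional probability of A1 = a1 given A2 = a2. -/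

import Mathlib

open scoped Classical
open Finset

noncomputable section

variable {Ω : Type*} [Fintype Ω]

/-- The probability P(X = x) of a random variable `X` on the finite
probability space `Ω` with probability mass function `p`. -/
def mprob {𝒳 : Type*} (p : Ω → ℝ) (X : Ω → 𝒳) (x : 𝒳) : ℝ :=
  ∑ ω, if X ω = x then p ω else 0

/-- The joint probability P(X = x, Y = y). -/
def jprob {𝒳 𝒴 : Type*} (p : Ω → ℝ) (X : Ω → 𝒳) (Y : Ω → 𝒴) (x : 𝒳) (y : 𝒴) : ℝ :=
  ∑ ω, if X ω = x ∧ Y ω = y then p ω else 0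

/-- The conditional probability P(X = x | Y = y). -/
def cprob {𝒳 𝒴 : Type*} (p : Ω → ℝ) (X : Ω → 𝒳) (Y : Ω → 𝒴) (x : 𝒳) (y : 𝒴) : ℝ :=
  jprob p X Y x y / mprob p Y y

/-- The conditional probability mass function of `p` given the event `Y = y`. -/
def condDist {𝒴 : Type*} (p : Ω → ℝ) (Y : Ω → 𝒴) (y : 𝒴) : Ω → ℝ :=
  fun ω => if Y ω = y then p ω / mprob p Y y else 0

/-- The probability of an event `E`. -/
def prEvent (p : Ω → ℝ) (E : Ω → Prop) : ℝ :=
  ∑ ω, if E ω then p ω else 0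

/-- Shannon entropy H(X) in nats. -/
def entropy {𝒳 : Type*} [Fintype 𝒳] (p : Ω → ℝ) (X : Ω → 𝒳) : ℝ :=
  -∑ x, mprob p X x * Real.log (mprob p X x)

/-- Conditional Shannon entropy H(X|Y) in nats. -/
def condEntropy {𝒳 𝒴 : Type*} [Fintype 𝒳] [Fintype 𝒴] (p : Ω → ℝ) (X : Ω → 𝒳) (Y : Ω → 𝒴) : ℝ :=
  -∑ x, ∑ y, jprob p X Y x y * Real.log (cprob p X Y x y)

/-- Shannon mutual information I(X;Y) in nats. -/
def mutInfo {𝒳 𝒴 : Type*} [Fintype 𝒳] [Fintype 𝒴] (p : Ω → ℝ) (X : Ω → 𝒳) (Y : Ω → 𝒴) : ℝ :=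
  ∑ x, ∑ y, jprob p X Y x y * Real.log (jprob p X Y x y / (mprob p X x * mprob p Y y))

/-- The expectation E[ P_{X|Y}(X|Y)^ρ ]. -/
def expPow {𝒳 𝒴 : Type*} (p : Ω → ℝ) (X : Ω → 𝒳) (Y : Ω → 𝒴) (ρ : ℝ) : ℝ :=
  ∑ ω, p ω * (cprob p X Y (X ω) (Y ω)) ^ ρ

end

theorem sum_mul_comp_eq_sum_mprob {Ω 𝒳 : Type*} [Fintype Ω] [Fintype 𝒳]
    (p : Ω → ℝ) (X : Ω → 𝒳) (g : 𝒳 → ℝ) :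
    ∑ ω, p ω * g (X ω) = ∑ x, mprob p X x * g x := by
  simp only [mprob, Finset.sum_mul, ite_mul, zero_mul]
  rw [Finset.sum_comm]
  refine Finset.sum_congr rfl fun ω _ => ?_
  simp

theorem jprob_eq_mprob_prodMk {Ω 𝒳 𝒴 : Type*} [Fintype Ω]
    (p : Ω → ℝ) (X : Ω → 𝒳) (Y : Ω → 𝒴) (x : 𝒳) (y : 𝒴) :
    jprob p X Y x y = mprob p (fun ω => (X ω, Y ω)) (x, y) := by
  simp only [jprob, mprob, Prod.mk.injEq]

theorem sum_mul_comp_eq_sum_jprob {Ω 𝒳 𝒴 : Type*} [Fintype Ω] [Fintype 𝒳] [Fintype 𝒴]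
    (p : Ω → ℝ) (X : Ω → 𝒳) (Y : Ω → 𝒴) (g : 𝒳 → 𝒴 → ℝ) :
    ∑ ω, p ω * g (X ω) (Y ω) = ∑ x, ∑ y, jprob p X Y x y * g x y := by
  rw [sum_mul_comp_eq_sum_mprob p (fun ω => (X ω, Y ω)) (fun z => g z.1 z.2),
    Fintype.sum_prod_type]
  simp only [jprob_eq_mprob_prodMk]

section Nonneg

variable {Ω 𝒳 𝒴 : Type*} [Fintype Ω] {p : Ω → ℝ}

theorem prEvent_nonneg (hp : ∀ ω, 0 ≤ p ω) (E : Ω → Prop) : 0 ≤ prEvent p E :=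
  Finset.sum_nonneg fun ω _ => by split_ifs <;> simp [hp]

theorem mprob_nonneg (hp : ∀ ω, 0 ≤ p ω) (X : Ω → 𝒳) (x : 𝒳) : 0 ≤ mprob p X x :=
  prEvent_nonneg hp fun ω => X ω = x

theorem jprob_nonneg (hp : ∀ ω, 0 ≤ p ω) (X : Ω → 𝒳) (Y : Ω → 𝒴) (x : 𝒳) (y : 𝒴) :
    0 ≤ jprob p X Y x y := by
  rw [jprob_eq_mprob_prodMk]
  exact mprob_nonneg hp _ _

theorem cprob_nonneg (hp : ∀ ω, 0 ≤ p ω) (X : Ω → 𝒳) (Y : Ω → 𝒴) (x : 𝒳) (y : 𝒴) :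
    0 ≤ cprob p X Y x y :=
  div_nonneg (jprob_nonneg hp X Y x y) (mprob_nonneg hp Y y)

theorem condDist_nonneg (hp : ∀ ω, 0 ≤ p ω) (Y : Ω → 𝒴) (y : 𝒴) (ω : Ω) :
    0 ≤ condDist p Y y ω := by
  unfold condDist
  split_ifs
  · exact div_nonneg (hp ω) (mprob_nonneg hp Y y)
  · exact le_rfl

theorem le_mprob_self (hp : ∀ ω, 0 ≤ p ω) (X : Ω → 𝒳) (ω : Ω) : p ω ≤ mprob p X (X ω) := by
  have h := Finset.single_le_sum (f := fun η => if X η = X ω then p η else 0)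
    (fun η _ => by split_ifs <;> simp [hp]) (Finset.mem_univ ω)
  simpa [mprob] using h

theorem le_jprob_self (hp : ∀ ω, 0 ≤ p ω) (X : Ω → 𝒳) (Y : Ω → 𝒴) (ω : Ω) :
    p ω ≤ jprob p X Y (X ω) (Y ω) := by
  rw [jprob_eq_mprob_prodMk]
  exact le_mprob_self hp (fun ω => (X ω, Y ω)) ω

theorem jprob_le_mprob_right (hp : ∀ ω, 0 ≤ p ω) (X : Ω → 𝒳) (Y : Ω → 𝒴) (x : 𝒳) (y : 𝒴) :
    jprob p X Y x y ≤ mprob p Y y := by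
  refine Finset.sum_le_sum fun ω _ => ?_
  by_cases h : Y ω = y <;> by_cases h' : X ω = x <;> simp [h, h', hp]

end Nonneg

theorem sum_jprob_left {Ω 𝒳 𝒴 : Type*} [Fintype Ω] [Fintype 𝒳]
    (p : Ω → ℝ) (X : Ω → 𝒳) (Y : Ω → 𝒴) (y : 𝒴) :
    ∑ x, jprob p X Y x y = mprob p Y y := by
  simp only [jprob, mprob]
  rw [Finset.sum_comm]
  refine Finset.sum_congr rfl fun ω _ => ?_
  simp [ite_and]

theorem sum_condDist {Ω 𝒴 : Type*} [Fintype Ω] {p : Ω → ℝ} {Y : Ω → 𝒴} {y : 𝒴}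
    (h : mprob p Y y ≠ 0) : ∑ ω, condDist p Y y ω = 1 := by
  have h' : ∑ ω, condDist p Y y ω = mprob p Y y / mprob p Y y := by
    conv_rhs => arg 1; unfold mprob
    rw [Finset.sum_div]
    exact Finset.sum_congr rfl fun ω _ => by simp only [condDist]; split_ifs <;> simp
  rw [h', div_self h]

/-- The mutual information is at most `log |𝒳| - H(X|Y)`; exponentiating and applying Jensen's
inequality bounds it by the moment of the conditional probability. -/
theorem exp_mul_mutInfo_le {Ω 𝒳 𝒴 : Type*} [Fintype Ω] [Fintype 𝒳] [Nonempty 𝒳] [Fintype 𝒴]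
    {q : Ω → ℝ} (hq0 : ∀ ω, 0 ≤ q ω) (hq1 : ∑ ω, q ω = 1) (X : Ω → 𝒳) (Y : Ω → 𝒴)
    {ρ : ℝ} (hρ : 0 ≤ ρ) :
    Real.exp (ρ * mutInfo q X Y) ≤ (Fintype.card 𝒳 : ℝ) ^ ρ * expPow q X Y ρ := by
  set M : ℝ := (Fintype.card 𝒳 : ℝ) with hM
  have hMpos : 0 < M := by rw [hM]; exact_mod_cast Fintype.card_pos
  let c : Ω → ℝ := fun ω => cprob q X Y (X ω) (Y ω)
  have hc : ∀ ω, 0 < q ω → 0 < c ω := fun ω h =>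
    div_pos (h.trans_le (le_jprob_self hq0 X Y ω)) (h.trans_le (le_mprob_self hq0 Y ω))
  have hI : mutInfo q X Y ≤ ∑ ω, q ω * Real.log (M * c ω) := by
    have hmarg : ∑ ω, q ω * (1 / (M * mprob q X (X ω))) ≤ 1 := by
      rw [sum_mul_comp_eq_sum_mprob q X fun x => 1 / (M * mprob q X x)]
      calc ∑ x, mprob q X x * (1 / (M * mprob q X x)) ≤ ∑ _x : 𝒳, 1 / M := by
            refine Finset.sum_le_sum fun x _ => ?_
            rcases eq_or_ne (mprob q X x) 0 with h | h
            · simp [h, hMpos.le]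
            · exact le_of_eq (by field_simp)
        _ = 1 := by
            rw [Finset.sum_const, Finset.card_univ, nsmul_eq_mul, ← hM]
            field_simp
    have hterm : ∀ ω, q ω * Real.log (jprob q X Y (X ω) (Y ω) /
          (mprob q X (X ω) * mprob q Y (Y ω)))
        ≤ q ω * Real.log (M * c ω) + (q ω * (1 / (M * mprob q X (X ω))) - q ω) := by
      intro ω
      rcases (hq0 ω).eq_or_lt with h | h
      · simp [← h]
      have hX : 0 < mprob q X (X ω) := h.trans_le (le_mprob_self hq0 X ω)
      have hY : 0 < mprob q Y (Y ω) := h.trans_le (le_mprob_self hq0 Y ω)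
      have hcω := hc ω h
      have hfac : jprob q X Y (X ω) (Y ω) / (mprob q X (X ω) * mprob q Y (Y ω))
          = M * c ω * (1 / (M * mprob q X (X ω))) := by
        simp only [c, cprob]
        field_simp
      rw [hfac, Real.log_mul (by positivity) (by positivity)]
      have hlog := Real.log_le_sub_one_of_pos (x := 1 / (M * mprob q X (X ω))) (by positivity)
      nlinarith [mul_le_mul_of_nonneg_left hlog h.le]
    have hsum := Finset.sum_le_sum fun ω (_ : ω ∈ Finset.univ) => hterm ω
    rw [Finset.sum_add_distrib, Finset.sum_sub_distrib, hq1,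
      sum_mul_comp_eq_sum_jprob q X Y fun x y =>
        Real.log (jprob q X Y x y / (mprob q X x * mprob q Y y))] at hsum
    unfold mutInfo
    linarith
  calc Real.exp (ρ * mutInfo q X Y)
      ≤ Real.exp (∑ ω, q ω * (ρ * Real.log (M * c ω))) := by
        refine Real.exp_le_exp.mpr ((mul_le_mul_of_nonneg_left hI hρ).trans_eq ?_)
        rw [Finset.mul_sum]
        exact Finset.sum_congr rfl fun ω _ => by ring
    _ ≤ ∑ ω, q ω * Real.exp (ρ * Real.log (M * c ω)) := by
        simpa only [smul_eq_mul] using convexOn_exp.map_sum_le (t := Finset.univ) (w := q)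
          (p := fun ω => ρ * Real.log (M * c ω)) (fun ω _ => hq0 ω) hq1 (fun _ _ => Set.mem_univ _)
    _ = M ^ ρ * expPow q X Y ρ := by
        rw [expPow, Finset.mul_sum]
        refine Finset.sum_congr rfl fun ω _ => ?_
        rcases (hq0 ω).eq_or_lt with h | h
        · simp [← h]
        have hcω := hc ω h
        rw [mul_comm ρ, ← Real.rpow_def_of_pos (by positivity), Real.mul_rpow hMpos.le hcω.le]
        simp only [c]
        ring

theorem mprob_mul_condDist {Ω 𝒴 : Type*} [Fintype Ω] {p : Ω → ℝ} (hp : ∀ ω, 0 ≤ p ω)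
    (Y : Ω → 𝒴) (y : 𝒴) (ω : Ω) :
    mprob p Y y * condDist p Y y ω = if Y ω = y then p ω else 0 := by
  unfold condDist
  split_ifs with h
  · subst h
    rcases eq_or_ne (mprob p Y (Y ω)) 0 with h0 | h0
    · have : p ω = 0 := le_antisymm (h0 ▸ le_mprob_self hp Y ω) (hp ω)
      simp [this]
    · field_simp
  · simp

/-- Averaging the conditional moments over the conditioning variable. -/
theorem sum_mprob_mul_expPow_condDist {Ω 𝒳 𝒴 𝒵 : Type*} [Fintype Ω] [Fintype 𝒵]
    {p : Ω → ℝ} (hp : ∀ ω, 0 ≤ p ω) (X : 𝒵 → Ω → 𝒳) (Y : Ω → 𝒴) (Z : Ω → 𝒵) (ρ : ℝ) :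
    ∑ z, mprob p Z z * expPow (condDist p Z z) (X z) Y ρ
      = ∑ ω, p ω * cprob (condDist p Z (Z ω)) (X (Z ω)) Y (X (Z ω) ω) (Y ω) ^ ρ := by
  simp only [expPow, Finset.mul_sum, ← mul_assoc, mprob_mul_condDist hp]
  rw [Finset.sum_comm]
  refine Finset.sum_congr rfl fun ω _ => ?_
  simp only [ite_mul, zero_mul]
  rw [Finset.sum_ite_eq]
  simp

theorem mprob_condDist {Ω 𝒴 𝒵 : Type*} [Fintype Ω] (p : Ω → ℝ) (Z : Ω → 𝒵) (Y : Ω → 𝒴)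
    (z : 𝒵) (y : 𝒴) : mprob (condDist p Z z) Y y = jprob p Z Y z y / mprob p Z z := by
  rw [jprob, Finset.sum_div]
  refine Finset.sum_congr rfl fun ω _ => ?_
  by_cases h : Y ω = y <;> by_cases h' : Z ω = z <;> simp [condDist, h, h']

theorem jprob_comp_condDist {Ω 𝒜 ℬ 𝒴 𝒵 : Type*} [Fintype Ω] [Fintype 𝒜]
    (p : Ω → ℝ) (A : Ω → 𝒜) (Y : Ω → 𝒴) (Z : Ω → 𝒵) (f : 𝒜 → ℬ) (z : 𝒵) (b : ℬ) (y : 𝒴) :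
    jprob (condDist p Z z) (fun ω => f (A ω)) Y b y
      = ∑ a, if f a = b then
          prEvent p (fun ω => A ω = a ∧ Z ω = z ∧ Y ω = y) / mprob p Z z else 0 := by
  have h : ∀ a, (if f a = b then
        prEvent p (fun ω => A ω = a ∧ Z ω = z ∧ Y ω = y) / mprob p Z z else 0)
      = ∑ ω, if A ω = a then (if f a = b ∧ Y ω = y then condDist p Z z ω else 0) else 0 := by
    intro a
    by_cases hb : f a = b
    · rw [if_pos hb, prEvent, Finset.sum_div]
      refine Finset.sum_congr rfl fun ω _ => ?_
      by_cases h1 : A ω = a <;> by_cases h2 : Y ω = y <;> by_cases h3 : Z ω = z <;>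
        simp [condDist, h1, h2, h3, hb]
    · simp [hb]
  simp only [h]
  rw [Finset.sum_comm, jprob]
  refine Finset.sum_congr rfl fun ω _ => ?_
  simp

/-- The probability, given `Y = y`, that `A` collides with `a` under the fixed map `f`. -/
noncomputable def collisionProb {Ω 𝒜 ℬ 𝒴 : Type*} [Fintype Ω] [Fintype 𝒜]
    (p : Ω → ℝ) (A : Ω → 𝒜) (Y : Ω → 𝒴) (f : 𝒜 → ℬ) (a : 𝒜) (y : 𝒴) : ℝ :=
  ∑ x, if f x = f a then cprob p A Y x y else 0

theorem collisionProb_nonneg {Ω 𝒜 ℬ 𝒴 : Type*} [Fintype Ω] [Fintype 𝒜]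
    {p : Ω → ℝ} (hp : ∀ ω, 0 ≤ p ω) (A : Ω → 𝒜) (Y : Ω → 𝒴) (f : 𝒜 → ℬ) (a : 𝒜) (y : 𝒴) :
    0 ≤ collisionProb p A Y f a y :=
  Finset.sum_nonneg fun x _ => by split_ifs <;> simp [cprob_nonneg hp]

theorem cprob_condDist_eq_collisionProb {Ω 𝒜 ℬ 𝒴 𝒵 : Type*} [Fintype Ω] [Fintype 𝒜]
    {p : Ω → ℝ} {A : Ω → 𝒜} {Y : Ω → 𝒴} {Z : Ω → 𝒵}
    (hindep : ∀ a z y, prEvent p (fun ω => A ω = a ∧ Z ω = z ∧ Y ω = y) * mprob p Y y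
      = jprob p A Y a y * jprob p Z Y z y)
    (f : 𝒜 → ℬ) (a : 𝒜) {z : 𝒵} {y : 𝒴}
    (hz : mprob p Z z ≠ 0) (hy : mprob p Y y ≠ 0) (hzy : jprob p Z Y z y ≠ 0) :
    cprob (condDist p Z z) (fun ω => f (A ω)) Y (f a) y = collisionProb p A Y f a y := by
  rw [cprob, jprob_comp_condDist, mprob_condDist, Finset.sum_div, collisionProb]
  refine Finset.sum_congr rfl fun x _ => ?_
  split_ifs
  · rw [cprob]
    field_simp
    linarith [hindep x z y]
  · simp

theorem sum_cprob_mul_ite {Ω 𝒴 𝒵 : Type*} [Fintype Ω] [Fintype 𝒵]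
    (p : Ω → ℝ) (Z : Ω → 𝒵) (Y : Ω → 𝒴) (y : 𝒴) (E : 𝒵 → Prop) :
    ∑ z, cprob p Z Y z y * (if E z then 1 else 0)
      = prEvent (condDist p Y y) fun ω => E (Z ω) := by
  have h := sum_mul_comp_eq_sum_mprob (condDist p Y y) Z fun z => if E z then (1 : ℝ) else 0
  simp only [mul_ite, mul_one, mul_zero] at h ⊢
  rw [prEvent, h]
  refine Finset.sum_congr rfl fun z _ => ?_
  rw [mprob_condDist, cprob]
  simp only [jprob, and_comm]

/-- Under a two-universal hash function the expected collision probability exceeds the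
probability of the point itself by at most `1 / |ℬ|`. -/
theorem sum_cprob_mul_collisionProb_le {Ω 𝒜 ℬ 𝒴 : Type*} [Fintype Ω] [Fintype 𝒜] [Fintype ℬ]
    {p : Ω → ℝ} (hp : ∀ ω, 0 ≤ p ω) (A : Ω → 𝒜) (Y : Ω → 𝒴) (F : Ω → 𝒜 → ℬ) {y : 𝒴}
    (hy : mprob p Y y ≠ 0)
    (htu : ∀ x₁ x₂ : 𝒜, x₁ ≠ x₂ →
      prEvent (condDist p Y y) (fun ω => F ω x₁ = F ω x₂) ≤ 1 / (Fintype.card ℬ : ℝ))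
    (a : 𝒜) :
    ∑ f, cprob p F Y f y * collisionProb p A Y f a y
      ≤ cprob p A Y a y + 1 / (Fintype.card ℬ : ℝ) := by
  have hswap : ∑ f, cprob p F Y f y * collisionProb p A Y f a y
      = ∑ x, cprob p A Y x y * prEvent (condDist p Y y) (fun ω => F ω x = F ω a) := by
    simp only [collisionProb, Finset.mul_sum]
    rw [Finset.sum_comm]
    refine Finset.sum_congr rfl fun x _ => ?_
    rw [← sum_cprob_mul_ite p F Y y fun f => f x = f a, Finset.mul_sum]
    refine Finset.sum_congr rfl fun f _ => ?_
    split_ifs <;> ring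
  have hsum : ∑ x, cprob p A Y x y = 1 := by
    simp only [cprob]
    rw [← Finset.sum_div, sum_jprob_left, div_self hy]
  rw [hswap]
  calc ∑ x, cprob p A Y x y * prEvent (condDist p Y y) (fun ω => F ω x = F ω a)
      ≤ ∑ x, ((if x = a then cprob p A Y x y else 0)
          + cprob p A Y x y * (1 / (Fintype.card ℬ : ℝ))) := by
        refine Finset.sum_le_sum fun x _ => ?_
        have hx := cprob_nonneg hp A Y x y
        split_ifs with h
        · subst h
          have hone : prEvent (condDist p Y y) (fun ω => F ω x = F ω x) = 1 := by
            simpa [prEvent] using sum_condDist hy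
          rw [hone, mul_one]
          exact le_add_of_nonneg_right (by positivity)
        · rw [zero_add]
          exact mul_le_mul_of_nonneg_left (htu x a h) hx
    _ = cprob p A Y a y + 1 / (Fintype.card ℬ : ℝ) := by
        rw [Finset.sum_add_distrib, ← Finset.sum_mul, hsum, one_mul]
        simp

theorem sum_cprob_mul_collisionProb_rpow_le {Ω 𝒜 ℬ 𝒴 : Type*}
    [Fintype Ω] [Fintype 𝒜] [Fintype ℬ]
    {p : Ω → ℝ} (hp : ∀ ω, 0 ≤ p ω) (A : Ω → 𝒜) (Y : Ω → 𝒴) (F : Ω → 𝒜 → ℬ) {y : 𝒴}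
    (hy : mprob p Y y ≠ 0)
    (htu : ∀ x₁ x₂ : 𝒜, x₁ ≠ x₂ →
      prEvent (condDist p Y y) (fun ω => F ω x₁ = F ω x₂) ≤ 1 / (Fintype.card ℬ : ℝ))
    (a : 𝒜) {ρ : ℝ} (hρ0 : 0 ≤ ρ) (hρ1 : ρ ≤ 1) :
    ∑ f, cprob p F Y f y * collisionProb p A Y f a y ^ ρ
      ≤ cprob p A Y a y ^ ρ + (1 / (Fintype.card ℬ : ℝ)) ^ ρ := by
  have hsum : ∑ f, cprob p F Y f y = 1 := by
    simp only [cprob]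
    rw [← Finset.sum_div, sum_jprob_left, div_self hy]
  calc ∑ f, cprob p F Y f y * collisionProb p A Y f a y ^ ρ
      ≤ (∑ f, cprob p F Y f y * collisionProb p A Y f a y) ^ ρ := by
        simpa only [smul_eq_mul] using (Real.concaveOn_rpow hρ0 hρ1).le_map_sum
          (t := Finset.univ) (w := fun f => cprob p F Y f y)
          (p := fun f => collisionProb p A Y f a y) (fun f _ => cprob_nonneg hp F Y f y) hsum
          (fun f _ => collisionProb_nonneg hp A Y f a y)
    _ ≤ (cprob p A Y a y + 1 / (Fintype.card ℬ : ℝ)) ^ ρ :=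
        Real.rpow_le_rpow
          (Finset.sum_nonneg fun f _ => mul_nonneg (cprob_nonneg hp F Y f y)
            (collisionProb_nonneg hp A Y f a y))
          (sum_cprob_mul_collisionProb_le hp A Y F hy htu a) hρ0
    _ ≤ cprob p A Y a y ^ ρ + (1 / (Fintype.card ℬ : ℝ)) ^ ρ :=
        Real.rpow_add_le_add_rpow (cprob_nonneg hp A Y a y) (by positivity) hρ0 hρ1

/-- Conditional independence splits an expectation of a function of `(A, Z, Y)`. -/
theorem sum_mul_comp_of_condIndep {Ω 𝒜 𝒴 𝒵 : Type*}
    [Fintype Ω] [Fintype 𝒜] [Fintype 𝒴] [Fintype 𝒵]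
    {p : Ω → ℝ} (hp : ∀ ω, 0 ≤ p ω) {A : Ω → 𝒜} {Y : Ω → 𝒴} {Z : Ω → 𝒵}
    (hindep : ∀ a z y, prEvent p (fun ω => A ω = a ∧ Z ω = z ∧ Y ω = y) * mprob p Y y
      = jprob p A Y a y * jprob p Z Y z y)
    (g : 𝒜 → 𝒵 → 𝒴 → ℝ) :
    ∑ ω, p ω * g (A ω) (Z ω) (Y ω)
      = ∑ a, ∑ y, jprob p A Y a y * ∑ z, cprob p Z Y z y * g a z y := by
  rw [sum_mul_comp_eq_sum_mprob p (fun ω => (A ω, Z ω, Y ω)) (fun t => g t.1 t.2.1 t.2.2)]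
  simp only [Fintype.sum_prod_type]
  refine Finset.sum_congr rfl fun a _ => ?_
  rw [Finset.sum_comm]
  refine Finset.sum_congr rfl fun y _ => ?_
  rw [Finset.mul_sum]
  refine Finset.sum_congr rfl fun z _ => ?_
  have htriple : mprob p (fun ω => (A ω, Z ω, Y ω)) (a, z, y)
      = prEvent p fun ω => A ω = a ∧ Z ω = z ∧ Y ω = y := by
    simp only [mprob, prEvent, Prod.mk.injEq]
    congr!
  rw [htriple, ← mul_assoc]
  congr 1
  rcases eq_or_ne (mprob p Y y) 0 with h | h
  · have hle : prEvent p (fun ω => A ω = a ∧ Z ω = z ∧ Y ω = y) ≤ mprob p Y y := by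
      refine Finset.sum_le_sum fun ω _ => ?_
      split_ifs with h₁ h₂ h₂
      · exact le_rfl
      · exact absurd h₁.2.2 h₂
      · exact hp ω
      · exact le_rfl
    rw [le_antisymm (h ▸ hle) (prEvent_nonneg hp _), cprob, h, div_zero, mul_zero]
  · rw [cprob, ← mul_div_assoc, eq_div_iff h, hindep]

/-- strengthened privacy amplification theorem.
If `A1` and `F` are conditionally independent given `A2` and, conditioned on
each realization `a2` of `A2`, the random function `F : 𝒜1 → 𝒜3` satisfies the
two-universal hashing condition, then for all `0 ≤ ρ ≤ 1`,
`E_f[exp(ρ · I(F(A1); A2 | F = f))] ≤ 1 + |𝒜3|^ρ · E[P_{A1|A2}(A1|A2)^ρ]`. -/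
theorem privacy_amplification
    {Ω 𝒜1 𝒜2 𝒜3 : Type*} [Fintype Ω] [Fintype 𝒜1] [Fintype 𝒜2] [Fintype 𝒜3]
    (p : Ω → ℝ) (hp0 : ∀ ω, 0 ≤ p ω) (hp1 : ∑ ω, p ω = 1)
    (A1 : Ω → 𝒜1) (A2 : Ω → 𝒜2) (F : Ω → (𝒜1 → 𝒜3))
    -- A1 and F are conditionally independent given A2
    (hindep : ∀ (a1 : 𝒜1) (f : 𝒜1 → 𝒜3) (a2 : 𝒜2),
      prEvent p (fun ω => A1 ω = a1 ∧ F ω = f ∧ A2 ω = a2) * mprob p A2 a2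
        = jprob p A1 A2 a1 a2 * jprob p F A2 f a2)
    -- conditioned on any realization a2 of A2, F is two-universal
    (htu : ∀ (a2 : 𝒜2) (x1 x2 : 𝒜1), x1 ≠ x2 →
      prEvent (condDist p A2 a2) (fun ω => F ω x1 = F ω x2) ≤ 1 / (Fintype.card 𝒜3 : ℝ))
    (ρ : ℝ) (hρ0 : 0 ≤ ρ) (hρ1 : ρ ≤ 1) :
    ∑ f : 𝒜1 → 𝒜3, mprob p F f *
        Real.exp (ρ * mutInfo (condDist p F f) (fun ω => f (A1 ω)) A2)
      ≤ 1 + (Fintype.card 𝒜3 : ℝ) ^ ρ * expPow p A1 A2 ρ := by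
  have hΩ : Nonempty Ω := by
    by_contra h
    rw [not_nonempty_iff] at h
    simp at hp1
  obtain ⟨ω₀⟩ := hΩ
  have : Nonempty 𝒜3 := ⟨F ω₀ (A1 ω₀)⟩
  set M : ℝ := (Fintype.card 𝒜3 : ℝ) with hM
  have hMpos : 0 < M := by rw [hM]; exact_mod_cast Fintype.card_pos
  calc ∑ f, mprob p F f * Real.exp (ρ * mutInfo (condDist p F f) (fun ω => f (A1 ω)) A2)
      ≤ ∑ f, M ^ ρ * (mprob p F f * expPow (condDist p F f) (fun ω => f (A1 ω)) A2 ρ) := by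
        refine Finset.sum_le_sum fun f _ => ?_
        rcases eq_or_ne (mprob p F f) 0 with h | h
        · simp [h]
        rw [mul_left_comm]
        exact mul_le_mul_of_nonneg_left
          (exp_mul_mutInfo_le (condDist_nonneg hp0 F f) (sum_condDist h) _ A2 hρ0)
          (mprob_nonneg hp0 F f)
    _ = M ^ ρ * ∑ ω, p ω * collisionProb p A1 A2 (F ω) (A1 ω) (A2 ω) ^ ρ := by
        rw [← Finset.mul_sum, sum_mprob_mul_expPow_condDist hp0 (fun f ω => f (A1 ω)) A2 F ρ]
        congr 1
        refine Finset.sum_congr rfl fun ω _ => ?_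
        rcases (hp0 ω).eq_or_lt with h | h
        · simp [← h]
        rw [cprob_condDist_eq_collisionProb hindep (F ω) (A1 ω)
          (h.trans_le (le_mprob_self hp0 F ω)).ne' (h.trans_le (le_mprob_self hp0 A2 ω)).ne'
          (h.trans_le (le_jprob_self hp0 F A2 ω)).ne']
    _ = M ^ ρ * ∑ a, ∑ y, jprob p A1 A2 a y *
          ∑ f, cprob p F A2 f y * collisionProb p A1 A2 f a y ^ ρ := by
        rw [sum_mul_comp_of_condIndep hp0 hindep fun a f y => collisionProb p A1 A2 f a y ^ ρ]
    _ ≤ M ^ ρ * ∑ a, ∑ y, jprob p A1 A2 a y * (cprob p A1 A2 a y ^ ρ + (1 / M) ^ ρ) := by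
        refine mul_le_mul_of_nonneg_left ?_ (by positivity)
        refine Finset.sum_le_sum fun a _ => Finset.sum_le_sum fun y _ => ?_
        rcases eq_or_ne (mprob p A2 y) 0 with h | h
        · have h0 : jprob p A1 A2 a y = 0 :=
            le_antisymm (h ▸ jprob_le_mprob_right hp0 A1 A2 a y) (jprob_nonneg hp0 A1 A2 a y)
          simp [h0]
        · exact mul_le_mul_of_nonneg_left
            (sum_cprob_mul_collisionProb_rpow_le hp0 A1 A2 F h (htu y) a hρ0 hρ1)
            (jprob_nonneg hp0 A1 A2 a y)
    _ = 1 + M ^ ρ * expPow p A1 A2 ρ := by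
        rw [← sum_mul_comp_eq_sum_jprob p A1 A2 fun a y => cprob p A1 A2 a y ^ ρ + (1 / M) ^ ρ]
        simp only [mul_add]
        rw [Finset.sum_add_distrib, ← Finset.sum_mul, hp1, one_mul, mul_add,
          ← Real.mul_rpow hMpos.le (by positivity), mul_one_div_cancel hMpos.ne', Real.one_rpow,
          add_comm, expPow]
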